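/- Let ρ ∈ (0,1]. Then the test function value ṽ_b(∞) is infinite; that is, the function y ↦ e^{2y} (∫_y^∞ f_ρ(z) dz) / f_ρ(y) is not integrable on [c,∞), i.e. ∫_c^∞ e^{2y} (∫_y^∞ f_ρ(z) dz)/f_ρ(y) dy = +∞. -/

import Mathlib

open MeasureTheory Real Set

lemma aux_int (A K m y : ℝ) (hK : 0 < K) :
    IntegrableOn (fun z => Real.exp (A * (z - m) ^ 2 - K * Real.exp z)) (Ici y) := by
  rw [integrableOn_Ici_iff_integrableOn_Ioi]
  refine integrable_of_isBigO_exp_neg (b := 1) one_pos (by fun_prop) ?_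
  have h2 := (isLittleO_pow_exp_atTop (n := 2)).const_mul_left A
  have h1 := (isLittleO_pow_exp_atTop (n := 1)).const_mul_left (1 - 2 * A * m)
  have h0 := (isLittleO_pow_exp_atTop (n := 0)).const_mul_left (A * m ^ 2)
  have h := ((h2.add h1).add h0).bound hK
  apply Asymptotics.IsBigO.of_bound 1
  filter_upwards [h] with z hz
  have hz' := (le_abs_self _).trans hz
  simp only [Real.norm_eq_abs, Real.abs_exp, one_mul] at hz' ⊢
  apply Real.exp_le_exp.mpr
  nlinarith

lemma aux_bd (A K m y : ℝ) (hA : 0 < A) (hK : 0 < K) (hy : 0 < y) (hm : m ≤ y) :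
    Real.exp (-(3 * K)) ≤ Real.exp (2 * y) *
      (∫ z in Ici y, Real.exp (A * (z - m) ^ 2 - K * Real.exp z)) /
        Real.exp (A * (y - m) ^ 2 - K * Real.exp y) := by
  set F := Real.exp (A * (y - m) ^ 2 - K * Real.exp y) with hF
  have hFp : 0 < F := Real.exp_pos _
  have hI := aux_int A K m y hK
  have ht0 : 0 < Real.exp (-y) := Real.exp_pos _
  have ht1 : Real.exp (-y) ≤ 1 := Real.exp_le_one_iff.mpr (by linarith)
  have hprod : Real.exp y * Real.exp (-y) = 1 := by rw [← Real.exp_add]; simp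
  have hpt : ∀ z ∈ Icc y (y + Real.exp (-y)),
      Real.exp (-(3 * K)) * F ≤ Real.exp (A * (z - m) ^ 2 - K * Real.exp z) := by
    intro z hz
    rw [hF, ← Real.exp_add]
    apply Real.exp_le_exp.mpr
    have e1 : (y - m) ^ 2 ≤ (z - m) ^ 2 := by nlinarith [hz.1]
    have e2 : Real.exp z ≤ Real.exp y + 3 := by
      have a1 : y - z + 1 ≤ Real.exp (y - z) := Real.add_one_le_exp _
      have a2 : Real.exp z ≤ Real.exp y * 3 := by
        have : Real.exp z ≤ Real.exp (y + 1) := Real.exp_le_exp.mpr (by linarith [hz.2])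
        rw [Real.exp_add] at this
        nlinarith [Real.exp_one_lt_d9, Real.exp_pos y]
      have a3 : Real.exp z * Real.exp (y - z) = Real.exp y := by
        rw [← Real.exp_add]; congr 1; ring
      have a4 : Real.exp z - Real.exp y ≤ Real.exp z * (z - y) := by
        nlinarith [Real.exp_pos z]
      have a5 : Real.exp z * (z - y) ≤ Real.exp y * 3 * Real.exp (-y) :=
        mul_le_mul a2 (by linarith [hz.2]) (by linarith [hz.1]) (by positivity)
      nlinarith
    nlinarith
  have hlow : Real.exp (-y) * (Real.exp (-(3 * K)) * F) ≤
      ∫ z in Ici y, Real.exp (A * (z - m) ^ 2 - K * Real.exp z) := by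
    calc _ = ∫ z in Icc y (y + Real.exp (-y)), Real.exp (-(3 * K)) * F := by
          simp [ht0.le]
      _ ≤ ∫ z in Icc y (y + Real.exp (-y)), Real.exp (A * (z - m) ^ 2 - K * Real.exp z) :=
          setIntegral_mono_on (integrableOn_const (by simp)) (hI.mono_set Icc_subset_Ici_self)
            measurableSet_Icc hpt
      _ ≤ _ := setIntegral_mono_set hI (Filter.Eventually.of_forall fun z => (Real.exp_pos _).le)
            (Icc_subset_Ici_self.eventuallyLE)
  rw [le_div_iff₀ hFp]
  have h1 : 1 ≤ Real.exp (2 * y) * Real.exp (-y) := by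
    rw [← Real.exp_add]; exact Real.one_le_exp (by linarith)
  have hp : 0 < Real.exp (-(3 * K)) * F := by positivity
  calc _ ≤ (Real.exp (2 * y) * Real.exp (-y)) * (Real.exp (-(3 * K)) * F) :=
        le_mul_of_one_le_left hp.le h1
    _ = Real.exp (2 * y) * (Real.exp (-y) * (Real.exp (-(3 * K)) * F)) := by ring
    _ ≤ _ := by gcongr

/-- For ρ ∈ (0,1], ṽ_b(∞) is infinite:
∫_c^∞ e^{2y} (∫_y^∞ f_ρ(z) dz)/f_ρ(y) dy = +∞. -/
theorem stmt_7 (α β m c ρ : ℝ) (hα : 0 < α) (hβ : 0 < β) (hm : 0 < m) (hc : 0 < c)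
    (hρ₁ : 0 < ρ) (hρ₂ : ρ ≤ 1) :
    ∫⁻ y in Ici c,
      ENNReal.ofReal
        (Real.exp (2 * y) *
          (∫ z in Ici y, Real.exp (α / β ^ 2 * (z - m) ^ 2 - 2 * ρ / β * Real.exp z)) /
          Real.exp (α / β ^ 2 * (y - m) ^ 2 - 2 * ρ / β * Real.exp y)) = ⊤ := by
  rw [eq_top_iff]
  calc (⊤ : ENNReal) = ∫⁻ y in Ici (max c m),
        ENNReal.ofReal (Real.exp (-(3 * (2 * ρ / β)))) := by
        rw [setLIntegral_const, Real.volume_Ici, ENNReal.mul_top]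
        simpa using Real.exp_pos _
    _ ≤ ∫⁻ y in Ici (max c m), _ := by
        refine setLIntegral_mono' measurableSet_Ici fun y hy => ENNReal.ofReal_le_ofReal ?_
        have h1 : c ≤ y := (le_max_left _ _).trans hy
        exact aux_bd (α / β ^ 2) (2 * ρ / β) m y (by positivity) (by positivity)
          (by linarith) ((le_max_right _ _).trans hy)
    _ ≤ _ := lintegral_mono_set (Ici_subset_Ici.mpr (le_max_left _ _))
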